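/- Let n ≥ 2 be an integer, λ > 0 and C > 0 real, and let T : [0,∞) → [0,∞) be a continuous increasing function with T(t) ≤ C·t^λ for all t ≥ 0. Define I_{n−2}(r; T) := ∫₀^r T(τ)(r²−τ²)^{n−2} τ dτ, φ_λ(t) := t^{2λ−1}/(1+t^{2λ})², and the operators (L[g])(r) := g'(r)/r and (M[φ])(r) := −(d/dt)(φ(t)/t)|_{t=r}. Then for all integers p ≥ 1 and q ≥ 0 with p + q = n − 1, one has lim_{t→0⁺} (1/t)·L^{p−1}[I_{n−2}(·; T)](t)·M^q[φ_λ](t) = 0 and lim_{t→+∞} (1/t)·L^{p−1}[I_{n−2}(·; T)](t)·M^q[φ_λ](t) = 0. -/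

import Mathlib

/-- The operator `L[g](r) = g'(r)/r`. -/
noncomputable def Lop : (ℝ → ℝ) → (ℝ → ℝ) := fun g r => deriv g r / r

/-- The operator `M[φ](r) = −(d/dt)(φ(t)/t)|_{t=r}`. -/
noncomputable def Mop : (ℝ → ℝ) → (ℝ → ℝ) := fun φ r => -deriv (fun t => φ t / t) r

/-- The integral `I_{n-2}(r; T) = ∫₀^r T(τ)(r²−τ²)^{n-2} τ dτ`. -/
noncomputable def Iop (T : ℝ → ℝ) (k : ℕ) (r : ℝ) : ℝ :=
  ∫ τ in (0:ℝ)..r, T τ * (r^2 - τ^2)^k * τ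

open Filter Topology Polynomial

lemma integral_mul_sub_sq_pow_succ {f : ℝ → ℝ} (hf : Continuous f) (k : ℕ) (r : ℝ) :
    ∫ τ in (0:ℝ)..r, f τ * (r ^ 2 - τ ^ 2) ^ (k + 1) =
      r ^ 2 * (∫ τ in (0:ℝ)..r, f τ * (r ^ 2 - τ ^ 2) ^ k) -
        ∫ τ in (0:ℝ)..r, (τ ^ 2 * f τ) * (r ^ 2 - τ ^ 2) ^ k := by
  rw [← intervalIntegral.integral_const_mul, ← intervalIntegral.integral_sub
    (Continuous.intervalIntegrable (by fun_prop) _ _)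
    (Continuous.intervalIntegrable (by fun_prop) _ _)]
  congr 1 with τ
  ring

/-- Differentiation in `r` of the kernel integral `∫₀^r f(τ)(r² - τ²)^(k+1) dτ`. -/
lemma hasDerivAt_integral_mul_sub_sq_pow (k : ℕ) {f : ℝ → ℝ} (hf : Continuous f) (r : ℝ) :
    HasDerivAt (fun r : ℝ => ∫ τ in (0:ℝ)..r, f τ * (r ^ 2 - τ ^ 2) ^ (k + 1))
      (2 * (k + 1) * r * ∫ τ in (0:ℝ)..r, f τ * (r ^ 2 - τ ^ 2) ^ k) r := by
  induction k generalizing f with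
  | zero =>
    simp_rw [integral_mul_sub_sq_pow_succ hf 0, pow_zero, mul_one]
    have hd : ∀ {g : ℝ → ℝ}, Continuous g →
        HasDerivAt (fun r : ℝ => ∫ τ in (0:ℝ)..r, g τ) (g r) r := fun hg =>
      intervalIntegral.integral_hasDerivAt_right (hg.intervalIntegrable _ _)
        (hg.stronglyMeasurableAtFilter _ _) hg.continuousAt
    refine HasDerivAt.congr_deriv (((hasDerivAt_pow 2 r).mul (hd hf)).sub
      (hd (g := fun τ => τ ^ 2 * f τ) (by fun_prop))) ?_
    push_cast
    ring
  | succ k ih =>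
    have hf₂ : Continuous fun τ => τ ^ 2 * f τ := by fun_prop
    have h := ((hasDerivAt_pow 2 r).mul (ih hf)).sub (ih hf₂)
    simp_rw [integral_mul_sub_sq_pow_succ hf (k + 1)]
    refine HasDerivAt.congr_deriv h ?_
    rw [integral_mul_sub_sq_pow_succ hf k]
    push_cast
    ring

lemma hasDerivAt_Iop_succ {T : ℝ → ℝ} (hT : ContinuousOn T (Set.Ici 0)) (k : ℕ)
    {r : ℝ} (hr : 0 < r) :
    HasDerivAt (Iop T (k + 1)) (2 * (k + 1) * r * Iop T k r) r := by
  have hg : Continuous fun τ => T (max 0 τ) * τ :=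
    (hT.comp_continuous (by fun_prop) fun τ => le_max_left 0 τ).mul continuous_id
  have hI : ∀ (j : ℕ) {s : ℝ}, 0 < s →
      Iop T j s = ∫ τ in (0:ℝ)..s, (T (max 0 τ) * τ) * (s ^ 2 - τ ^ 2) ^ j := by
    intro j s hs
    refine intervalIntegral.integral_congr fun τ hτ => ?_
    rw [Set.uIcc_of_le hs.le] at hτ
    simp only [max_eq_right hτ.1]
    ring
  rw [hI k hr]
  refine (hasDerivAt_integral_mul_sub_sq_pow k hg r).congr_of_eventuallyEq ?_
  filter_upwards [lt_mem_nhds hr] with s hs using hI _ hs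

lemma Lop_iterate_Iop {T : ℝ → ℝ} (hT : ContinuousOn T (Set.Ici 0)) (k j : ℕ) :
    ∃ c : ℝ, ∀ t > 0, Lop^[j] (Iop T (k + j)) t = c * Iop T k t := by
  induction j generalizing k with
  | zero => exact ⟨1, fun t _ => by simp⟩
  | succ j ih =>
    obtain ⟨c, hc⟩ := ih (k + 1)
    refine ⟨c * (2 * (k + 1)), fun t ht => ?_⟩
    have heq : Lop^[j] (Iop T (k + (j + 1))) =ᶠ[𝓝 t] fun s => c * Iop T (k + 1) s := by
      filter_upwards [lt_mem_nhds ht] with s hs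
      rw [← hc s hs, add_right_comm, add_assoc]
    rw [Function.iterate_succ_apply', Lop, heq.deriv_eq,
      ((hasDerivAt_Iop_succ hT k ht).const_mul c).deriv]
    field_simp

lemma abs_Iop_le {T : ℝ → ℝ} {C lam : ℝ} (hlam : 0 < lam) (hC : 0 < C)
    (hTnonneg : ∀ t ∈ Set.Ici (0:ℝ), 0 ≤ T t) (hTbound : ∀ t : ℝ, 0 ≤ t → T t ≤ C * t ^ lam)
    (k : ℕ) {t : ℝ} (ht : 0 < t) :
    |Iop T k t| ≤ C * t ^ lam * (t ^ 2) ^ k * t ^ 2 := by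
  have h : ∀ τ ∈ Set.uIoc 0 t,
      ‖T τ * (t ^ 2 - τ ^ 2) ^ k * τ‖ ≤ C * t ^ lam * (t ^ 2) ^ k * t := by
    intro τ hτ
    rw [Set.uIoc_of_le ht.le] at hτ
    have hτ0 := hτ.1.le
    have hsq : 0 ≤ t ^ 2 - τ ^ 2 := sub_nonneg.2 (pow_le_pow_left₀ hτ0 hτ.2 2)
    have hT0 := hTnonneg τ hτ0
    rw [Real.norm_of_nonneg (by positivity)]
    gcongr
    · exact (hTbound τ hτ0).trans (by gcongr; exact hτ.2)
    · linarith [sq_nonneg τ]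
    · exact hτ.2
  have := intervalIntegral.norm_integral_le_of_norm_le_const h
  rw [sub_zero, abs_of_pos ht, Real.norm_eq_abs] at this
  exact this.trans_eq (by ring)

lemma hasDerivAt_inv_one_add_rpow (a : ℝ) {t : ℝ} (ht : 0 < t) :
    HasDerivAt (fun s : ℝ => (1 + s ^ a)⁻¹)
      (-a * ((1 + t ^ a)⁻¹ * (1 - (1 + t ^ a)⁻¹)) / t) t := by
  have hpos : 0 < t ^ a := Real.rpow_pos_of_pos ht a
  have h := ((Real.hasDerivAt_rpow_const (p := a) (Or.inl ht.ne')).const_add 1).inv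
    (by positivity)
  refine HasDerivAt.congr_deriv h ?_
  rw [Real.rpow_sub_one ht.ne']
  field_simp
  ring

/-- In the variable `u = (1 + t^(2λ))⁻¹`, the iterates of `M` on `φ_λ` are, up to a power of `t`,
polynomials divisible by `u (1 - u)`. -/
lemma Mop_iterate_eq_polynomial {lam : ℝ} {φ : ℝ → ℝ}
    (hφ : ∀ t > (0:ℝ), φ t = t ^ (2*lam - 1) / (1 + t ^ (2*lam))^2) (q : ℕ) :
    ∃ P : ℝ[X], ∀ t > 0, Mop^[q] φ t =
      (X * (1 - X) * P).eval (1 + t ^ (2*lam))⁻¹ / t ^ (2 * q + 1) := by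
  induction q with
  | zero =>
    refine ⟨1, fun t ht => ?_⟩
    have hpos : 0 < t ^ (2*lam) := Real.rpow_pos_of_pos ht _
    rw [Function.iterate_zero_apply, hφ t ht, Real.rpow_sub_one ht.ne']
    simp only [eval_mul, eval_X, eval_sub, eval_one]
    field_simp
    ring
  | succ q ih =>
    obtain ⟨P, hP⟩ := ih
    refine ⟨Polynomial.C (2 * q + 2 : ℝ) * P +
      Polynomial.C (2 * lam) * derivative (X * (1 - X) * P), fun t ht => ?_⟩
    have heq : (fun s => Mop^[q] φ s / s) =ᶠ[𝓝 t]
        fun s => (X * (1 - X) * P).eval (1 + s ^ (2*lam))⁻¹ / s ^ (2 * q + 2) := by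
      filter_upwards [lt_mem_nhds ht] with s hs
      rw [hP s hs, div_div, ← pow_succ]
    have hd := (((X * (1 - X) * P).hasDerivAt _).comp t
      (hasDerivAt_inv_one_add_rpow (2*lam) ht)).div (hasDerivAt_pow (2 * q + 2) t)
      (by positivity)
    rw [Function.iterate_succ_apply', Mop, heq.deriv_eq]
    refine (congrArg Neg.neg hd.deriv).trans ?_
    simp only [Function.comp_apply, eval_mul, eval_add, eval_C, eval_X, eval_sub, eval_one]
    generalize (1 + t ^ (2*lam))⁻¹ = u
    generalize eval u (derivative (X * (1 - X) * P)) = d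
    have : 2 * q + 2 - 1 = 2 * q + 1 := rfl
    rw [this]
    push_cast
    field_simp
    ring

lemma exists_abs_Mop_iterate_le {lam : ℝ} {φ : ℝ → ℝ}
    (hφ : ∀ t > (0:ℝ), φ t = t ^ (2*lam - 1) / (1 + t ^ (2*lam))^2) (q : ℕ) :
    ∃ K : ℝ, 0 ≤ K ∧ ∀ t > 0, |Mop^[q] φ t| ≤
      K * (t ^ (2*lam) / (1 + t ^ (2*lam)) ^ 2) / t ^ (2 * q + 1) := by
  obtain ⟨P, hP⟩ := Mop_iterate_eq_polynomial hφ q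
  obtain ⟨K, hK⟩ := (isCompact_Icc (a := (0:ℝ)) (b := 1)).exists_bound_of_continuousOn
    P.continuous.continuousOn
  refine ⟨K, (norm_nonneg _).trans (hK 0 (by simp)), fun t ht => ?_⟩
  have hpos : 0 < t ^ (2*lam) := Real.rpow_pos_of_pos ht _
  have hu := hK (1 + t ^ (2*lam))⁻¹ ⟨by positivity, inv_le_one_of_one_le₀ (by linarith)⟩
  have hw : (1 + t ^ (2*lam))⁻¹ * (1 - (1 + t ^ (2*lam))⁻¹) =
      t ^ (2*lam) / (1 + t ^ (2*lam)) ^ 2 := by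
    field_simp
    ring
  rw [hP t ht, abs_div, abs_of_pos (by positivity : 0 < t ^ (2 * q + 1)), eval_mul, abs_mul]
  simp only [eval_mul, eval_X, eval_sub, eval_one]
  rw [hw, abs_of_pos (by positivity), mul_comm]
  gcongr
  exact hu

/-- Lemma 5: vanishing of the boundary terms at `0⁺` and `+∞`. -/
theorem stmt_12 (n : ℕ) (hn : 2 ≤ n) (lam : ℝ) (hlam : 0 < lam) (C : ℝ) (hC : 0 < C)
    (T : ℝ → ℝ) (hTcont : ContinuousOn T (Set.Ici 0))
    (hTnonneg : ∀ t ∈ Set.Ici (0:ℝ), 0 ≤ T t)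
    (hTmono : MonotoneOn T (Set.Ici 0))
    (hTbound : ∀ t : ℝ, 0 ≤ t → T t ≤ C * t ^ lam)
    (φ : ℝ → ℝ) (hφ : ∀ t > (0:ℝ), φ t = t ^ (2*lam - 1) / (1 + t ^ (2*lam))^2)
    (p q : ℕ) (hp : 1 ≤ p) (hpq : p + q = n - 1) :
    Filter.Tendsto (fun t => (1/t) * (Lop^[p-1]) (Iop T (n-2)) t * (Mop^[q]) φ t)
      (nhdsWithin 0 (Set.Ioi 0)) (nhds 0) ∧
    Filter.Tendsto (fun t => (1/t) * (Lop^[p-1]) (Iop T (n-2)) t * (Mop^[q]) φ t)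
      Filter.atTop (nhds 0) := by
  obtain ⟨j, rfl⟩ : ∃ j, p = j + 1 := ⟨p - 1, by omega⟩
  have hn2 : n - 2 = q + j := by omega
  obtain ⟨c, hc⟩ := Lop_iterate_Iop hTcont q j
  obtain ⟨K, hK0, hK⟩ := exists_abs_Mop_iterate_le hφ q
  rw [hn2, Nat.add_sub_cancel]
  have hbound : ∀ t > 0, ‖1 / t * Lop^[j] (Iop T (q + j)) t * Mop^[q] φ t‖ ≤
      |c| * C * K * (t ^ lam * (t ^ (2*lam) / (1 + t ^ (2*lam)) ^ 2)) := by
    intro t ht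
    rw [hc t ht, Real.norm_eq_abs, abs_mul, abs_mul, abs_mul, abs_of_pos (one_div_pos.2 ht)]
    calc 1 / t * (|c| * |Iop T q t|) * |Mop^[q] φ t|
        ≤ 1 / t * (|c| * (C * t ^ lam * (t ^ 2) ^ q * t ^ 2)) *
          (K * (t ^ (2*lam) / (1 + t ^ (2*lam)) ^ 2) / t ^ (2 * q + 1)) := by
          gcongr
          · exact abs_Iop_le hlam hC hTnonneg hTbound q ht
          · exact hK t ht
      _ = _ := by
          rw [← pow_mul]
          field_simp
          ring
  have hsq : ∀ t > (0:ℝ), t ^ (2*lam) = (t ^ lam) ^ 2 := fun t ht => by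
    rw [mul_comm, Real.rpow_mul ht.le, Real.rpow_two]
  constructor
  · have hlim : Tendsto (fun t : ℝ => |c| * C * K * t ^ lam) (𝓝[>] 0) (𝓝 0) := by
      have := ((Real.continuousAt_rpow_const 0 lam (Or.inr hlam.le)).tendsto.mono_left
        (nhdsWithin_le_nhds (s := Set.Ioi 0))).const_mul (|c| * C * K)
      simpa [Real.zero_rpow hlam.ne'] using this
    refine squeeze_zero_norm' ?_ hlim
    filter_upwards [self_mem_nhdsWithin] with t ht
    refine (hbound t ht).trans ?_
    have hx : 0 < t ^ lam := Real.rpow_pos_of_pos ht _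
    rw [hsq t ht]
    refine mul_le_mul_of_nonneg_left (mul_le_of_le_one_right hx.le ?_) (by positivity)
    rw [div_le_one (by positivity)]
    nlinarith [sq_nonneg (t ^ lam), sq_nonneg ((t ^ lam) ^ 2)]
  · have hlim : Tendsto (fun t : ℝ => |c| * C * K * (t ^ lam)⁻¹) atTop (𝓝 0) := by
      simpa using ((tendsto_rpow_atTop hlam).inv_tendsto_atTop).const_mul (|c| * C * K)
    refine squeeze_zero_norm' ?_ hlim
    filter_upwards [eventually_gt_atTop 0] with t ht
    refine (hbound t ht).trans ?_
    have hx : 0 < t ^ lam := Real.rpow_pos_of_pos ht _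
    rw [hsq t ht]
    refine mul_le_mul_of_nonneg_left ?_ (by positivity)
    rw [← mul_div_assoc, div_le_iff₀ (by positivity), ← div_eq_inv_mul, le_div_iff₀ hx]
    nlinarith [sq_nonneg (t ^ lam)]
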